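/- For every positive integer d, the 2^d + 1 polygonal curves τ_i with vertex sequence (0, i, i − 1/2, 2^d + 2) for i = 1,…,2^d + 1 all satisfy d_F(τ_i, c) ≤ 1/8, where c is the polygonal curve with vertex sequence (0, 7/8, 5/8, 15/8, 13/8, …, i − 1/8, i − 3/8, …, 2^d + 7/8, 2^d + 5/8, 2^d + 2), and d_F(τ_i, τ_j) = 1/4 for all i ≠ j. Consequently, for every positive integer d there is a closed ball of radius 1/8 in the space of polygonal curves with the Fréchet distance that cannot be covered by 2^d closed balls of radius 1/16; hence the doubling dimension of this metric space is unbounded. -/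

import Mathlib

open Set

/-- A valid reparametrization of `[0,1]`: a continuous strictly increasing
bijection of `[0,1]` onto itself fixing the endpoints. -/
def IsReparam (f : ℝ → ℝ) : Prop :=
  ContinuousOn f (Set.Icc 0 1) ∧ StrictMonoOn f (Set.Icc 0 1) ∧ f 0 = 0 ∧ f 1 = 1

/-- The Fréchet distance between two curves `τ, π : [0,1] → ℝ`:
`inf_f sup_{t ∈ [0,1]} |τ(f(t)) - π(t)|` over reparametrizations `f`. -/
noncomputable def frechetDist (τ π : ℝ → ℝ) : ℝ :=
  ⨅ f : {f : ℝ → ℝ // IsReparam f}, ⨆ t : Set.Icc (0:ℝ) 1, |τ (f.1 ↑t) - π ↑t|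

/-- `τ` is the polygonal curve on `[0,1]` with the `m` vertices `w 0, …, w (m-1)`
attained at parameters `t 0 = 0 < t 1 < … < t (m-1) = 1`, obtained by linear
interpolation. -/
def IsPolyOn (τ : ℝ → ℝ) (m : ℕ) (t w : ℕ → ℝ) : Prop :=
  2 ≤ m ∧ t 0 = 0 ∧ t (m - 1) = 1 ∧ (∀ i, i + 1 < m → t i < t (i + 1)) ∧
  (∀ i, i + 1 < m → ∀ u ∈ Set.Icc (t i) (t (i + 1)),
    τ u = w i + (u - t i) / (t (i + 1) - t i) * (w (i + 1) - w i))

/-- `τ` is a polygonal curve (with finitely many vertices). -/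
def IsPolyCurve (τ : ℝ → ℝ) : Prop := ∃ m t w, IsPolyOn τ m t w

/-- `c` is a polygonal curve with at most `ℓ` vertices, i.e. an element of `Δ_ℓ`. -/
def InDeltaL (ℓ : ℕ) (c : ℝ → ℝ) : Prop := ∃ m t w, m ≤ ℓ ∧ IsPolyOn c m t w

/-- General position of the vertex sequence `w 0, …, w (m-1)`: pairwise distinct
vertex values, pairwise distinct differences, and no vertex inside the closed
interval spanned by its two neighbours. -/
def GenPos (m : ℕ) (w : ℕ → ℝ) : Prop :=
  (∀ i j, i < m → j < m → i ≠ j → w i ≠ w j) ∧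
  (∀ i j p q, i < m → j < m → p < m → q < m → i ≠ j → p ≠ q →
      (i, j) ≠ (p, q) → w i - w j ≠ w p - w q) ∧
  (∀ i, i + 2 < m → w (i + 1) ∉ Set.uIcc (w i) (w (i + 2)))

/-- The parameters `s 0 = 0 < s 1 < … < s (ℓ-1) = 1` define a `δ`-signature of the
curve `τ` (Definition 3.3 of the paper, `0`-indexed): non-degeneracy,
direction-preservation, minimum edge length and range conditions. -/
def IsSignature (δ : ℝ) (τ : ℝ → ℝ) (ℓ : ℕ) (s : ℕ → ℝ) : Prop :=
  2 ≤ ℓ ∧ s 0 = 0 ∧ s (ℓ - 1) = 1 ∧ (∀ i, i + 1 < ℓ → s i < s (i + 1)) ∧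
  (∀ i, 1 ≤ i → i + 1 < ℓ → τ (s i) ∉ Set.uIcc (τ (s (i - 1))) (τ (s (i + 1)))) ∧
  (∀ i, i + 1 < ℓ → ∀ a b : ℝ, s i ≤ a → a < b → b ≤ s (i + 1) →
      (τ (s i) < τ (s (i + 1)) → τ a - τ b ≤ 2 * δ) ∧
      (τ (s (i + 1)) < τ (s i) → τ b - τ a ≤ 2 * δ)) ∧
  (∀ i, 1 ≤ i → i + 3 ≤ ℓ → 2 * δ < |τ (s (i + 1)) - τ (s i)|) ∧
  δ < |τ (s 1) - τ (s 0)| ∧ δ < |τ (s (ℓ - 1)) - τ (s (ℓ - 2))| ∧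
  (∀ i, 1 ≤ i → i + 3 ≤ ℓ → ∀ a ∈ Set.Icc (s i) (s (i + 1)),
      τ a ∈ Set.uIcc (τ (s i)) (τ (s (i + 1)))) ∧
  (2 < ℓ → ∀ a ∈ Set.Icc (s 0) (s 1),
      τ a ∈ Set.uIcc (τ (s 0)) (τ (s 1)) ∪ Set.Icc (τ (s 0) - δ) (τ (s 0) + δ)) ∧
  (2 < ℓ → ∀ a ∈ Set.Icc (s (ℓ - 2)) (s (ℓ - 1)),
      τ a ∈ Set.uIcc (τ (s (ℓ - 2))) (τ (s (ℓ - 1))) ∪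
        Set.Icc (τ (s (ℓ - 1)) - δ) (τ (s (ℓ - 1)) + δ)) ∧
  (ℓ = 2 → ∀ a ∈ Set.Icc (s 0) (s 1),
      τ a ∈ Set.uIcc (τ (s 0)) (τ (s 1)) ∪ Set.Icc (τ (s 0) - δ) (τ (s 0) + δ) ∪
        Set.Icc (τ (s 1) - δ) (τ (s 1) + δ))

/-! ### Reparametrizations -/

namespace IsReparam

variable {f g : ℝ → ℝ}

theorem mapsTo (hf : IsReparam f) : MapsTo f (Icc 0 1) (Icc 0 1) := by
  intro t ht
  have h0 := hf.2.1.monotoneOn (left_mem_Icc.2 zero_le_one) ht ht.1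
  have h1 := hf.2.1.monotoneOn ht (right_mem_Icc.2 zero_le_one) ht.2
  rw [hf.2.2.1] at h0
  rw [hf.2.2.2] at h1
  exact ⟨h0, h1⟩

theorem surjOn (hf : IsReparam f) : SurjOn f (Icc 0 1) (Icc 0 1) := by
  have h := intermediate_value_Icc zero_le_one hf.1
  rwa [hf.2.2.1, hf.2.2.2] at h

theorem comp (hf : IsReparam f) (hg : IsReparam g) : IsReparam (f ∘ g) :=
  ⟨hf.1.comp hg.1 hg.mapsTo, hf.2.1.comp hg.2.1 hg.mapsTo,
    by simp [hg.2.2.1, hf.2.2.1], by simp [hg.2.2.2, hf.2.2.2]⟩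

theorem exists_inverse (hf : IsReparam f) :
    ∃ g, IsReparam g ∧ ∀ t ∈ Icc (0 : ℝ) 1, f (g t) = t := by
  have hmono : StrictMono (hf.mapsTo.restrict f (Icc 0 1) (Icc 0 1)) :=
    fun a b hab => hf.2.1 a.2 b.2 hab
  have hsurj : Function.Surjective (hf.mapsTo.restrict f (Icc 0 1) (Icc 0 1)) := by
    intro y
    obtain ⟨x, hx, hxy⟩ := hf.surjOn y.2
    exact ⟨⟨x, hx⟩, Subtype.ext hxy⟩
  let e := hmono.orderIsoOfSurjective _ hsurj
  have he : ∀ x, f (e.symm x : ℝ) = x := fun x =>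
    congrArg Subtype.val (e.apply_symm_apply x)
  have hinj := hf.2.1.injOn
  have hval : ∀ t (ht : t ∈ Icc (0 : ℝ) 1),
      (e.symm (projIcc 0 1 zero_le_one t) : ℝ) = e.symm ⟨t, ht⟩ := fun t ht => by
    rw [projIcc_of_mem _ ht]
  refine ⟨fun t => e.symm (projIcc 0 1 zero_le_one t), ⟨?_, ?_, ?_, ?_⟩, ?_⟩
  · exact (continuous_subtype_val.comp
      (e.symm.continuous.comp continuous_projIcc)).continuousOn
  · intro a ha b hb hab
    change (e.symm _ : ℝ) < e.symm _
    rw [hval a ha, hval b hb]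
    exact e.symm.strictMono hab
  · refine hinj (e.symm _).2 (left_mem_Icc.2 zero_le_one) ?_
    rw [he, hf.2.2.1, projIcc_left]
  · refine hinj (e.symm _).2 (right_mem_Icc.2 zero_le_one) ?_
    rw [he, hf.2.2.2, projIcc_right]
  · intro t ht
    change f (e.symm _ : ℝ) = t
    rw [he, projIcc_of_mem _ ht]

end IsReparam

theorem isReparam_id : IsReparam id :=
  ⟨continuousOn_id, strictMonoOn_id, rfl, rfl⟩

/-! ### Basic properties of the Fréchet distance -/

theorem frechetDist_le_of_isReparam {τ π f : ℝ → ℝ} {r : ℝ} (hf : IsReparam f)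
    (h : ∀ t ∈ Icc (0 : ℝ) 1, |τ (f t) - π t| ≤ r) : frechetDist τ π ≤ r := by
  have hbdd : BddBelow (range fun f : {f : ℝ → ℝ // IsReparam f} =>
      ⨆ t : Icc (0 : ℝ) 1, |τ (f.1 t) - π t|) := by
    refine ⟨0, ?_⟩
    rintro _ ⟨g, rfl⟩
    exact Real.iSup_nonneg fun t => abs_nonneg _
  refine (ciInf_le hbdd ⟨f, hf⟩).trans ?_
  have : Nonempty (Icc (0 : ℝ) 1) := ⟨⟨0, left_mem_Icc.2 zero_le_one⟩⟩
  exact ciSup_le fun t => h t t.2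

theorem exists_isReparam_of_frechetDist_lt {τ π : ℝ → ℝ} {r : ℝ}
    (hτ : ContinuousOn τ (Icc 0 1)) (hπ : ContinuousOn π (Icc 0 1))
    (h : frechetDist τ π < r) :
    ∃ f, IsReparam f ∧ ∀ t ∈ Icc (0 : ℝ) 1, |τ (f t) - π t| < r := by
  have : Nonempty {f : ℝ → ℝ // IsReparam f} := ⟨⟨id, isReparam_id⟩⟩
  obtain ⟨⟨f, hf⟩, hlt⟩ := exists_lt_of_ciInf_lt h
  refine ⟨f, hf, fun t ht => ?_⟩
  have hcont : ContinuousOn (fun t => |τ (f t) - π t|) (Icc 0 1) :=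
    ((hτ.comp hf.1 hf.mapsTo).sub hπ).abs
  have hbdd : BddAbove (range fun t : Icc (0 : ℝ) 1 => |τ (f t) - π t|) := by
    have := isCompact_Icc.bddAbove_image hcont
    rwa [image_eq_range] at this
  exact (le_ciSup hbdd ⟨t, ht⟩).trans_lt hlt

theorem frechetDist_le_of_forall_gt {τ π : ℝ → ℝ} {r : ℝ}
    (h : ∀ ε > 0, ∃ f, IsReparam f ∧ ∀ t ∈ Icc (0 : ℝ) 1, |τ (f t) - π t| ≤ r + ε) :
    frechetDist τ π ≤ r := by
  refine le_of_forall_pos_le_add fun ε hε => ?_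
  obtain ⟨f, hf, hle⟩ := h ε hε
  exact frechetDist_le_of_isReparam hf hle

theorem frechetDist_comm_le {τ π : ℝ → ℝ}
    (hτ : ContinuousOn τ (Icc 0 1)) (hπ : ContinuousOn π (Icc 0 1)) :
    frechetDist π τ ≤ frechetDist τ π := by
  refine frechetDist_le_of_forall_gt fun ε hε => ?_
  obtain ⟨f, hf, hlt⟩ := exists_isReparam_of_frechetDist_lt hτ hπ (lt_add_of_pos_right _ hε)
  obtain ⟨g, hg, hfg⟩ := hf.exists_inverse
  refine ⟨g, hg, fun t ht => ?_⟩
  have := hlt (g t) (hg.mapsTo ht)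
  rw [hfg t ht, abs_sub_comm] at this
  exact this.le

theorem frechetDist_comm {τ π : ℝ → ℝ}
    (hτ : ContinuousOn τ (Icc 0 1)) (hπ : ContinuousOn π (Icc 0 1)) :
    frechetDist τ π = frechetDist π τ :=
  le_antisymm (frechetDist_comm_le hπ hτ) (frechetDist_comm_le hτ hπ)

theorem frechetDist_triangle {τ π ρ : ℝ → ℝ} (hτ : ContinuousOn τ (Icc 0 1))
    (hπ : ContinuousOn π (Icc 0 1)) (hρ : ContinuousOn ρ (Icc 0 1)) :
    frechetDist τ ρ ≤ frechetDist τ π + frechetDist π ρ := by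
  refine frechetDist_le_of_forall_gt fun ε hε => ?_
  obtain ⟨f, hf, hf'⟩ := exists_isReparam_of_frechetDist_lt hτ hπ
    (lt_add_of_pos_right _ (half_pos hε))
  obtain ⟨g, hg, hg'⟩ := exists_isReparam_of_frechetDist_lt hπ hρ
    (lt_add_of_pos_right _ (half_pos hε))
  refine ⟨f ∘ g, hf.comp hg, fun t ht => ?_⟩
  have h1 := hf' (g t) (hg.mapsTo ht)
  have h2 := hg' t ht
  have h3 := abs_sub_le (τ (f (g t))) (π (g t)) (ρ t)
  simp only [Function.comp_apply]
  linarith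

/-! ### Weakly monotone matchings -/

theorem isReparam_convexCombo_id {σ : ℝ → ℝ} (hc : Continuous σ) (hm : Monotone σ)
    (h0 : σ 0 = 0) (h1 : σ 1 = 1) {ε : ℝ} (hε : 0 < ε) (hε1 : ε ≤ 1) :
    IsReparam fun u => (1 - ε) * σ u + ε * u := by
  refine ⟨by fun_prop, fun a _ b _ hab => ?_, by simp [h0], by simp [h1]⟩
  have h2 := mul_le_mul_of_nonneg_left (hm hab.le) (sub_nonneg.2 hε1)
  have h3 := mul_lt_mul_of_pos_left hab hε
  simp only
  linarith

theorem frechetDist_le_of_monotone {τ π σ ρ : ℝ → ℝ} {r : ℝ}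
    (hτ : ContinuousOn τ (Icc 0 1)) (hπ : ContinuousOn π (Icc 0 1))
    (hσc : Continuous σ) (hσm : Monotone σ) (hσ0 : σ 0 = 0) (hσ1 : σ 1 = 1)
    (hρc : Continuous ρ) (hρm : Monotone ρ) (hρ0 : ρ 0 = 0) (hρ1 : ρ 1 = 1)
    (h : ∀ u ∈ Icc (0 : ℝ) 1, |τ (σ u) - π (ρ u)| ≤ r) : frechetDist τ π ≤ r := by
  refine frechetDist_le_of_forall_gt fun δ hδ => ?_
  obtain ⟨ε₁, hε₁, h₁⟩ := Metric.uniformContinuousOn_iff.1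
    (isCompact_Icc.uniformContinuousOn_of_continuous hτ) (δ / 2) (half_pos hδ)
  obtain ⟨ε₂, hε₂, h₂⟩ := Metric.uniformContinuousOn_iff.1
    (isCompact_Icc.uniformContinuousOn_of_continuous hπ) (δ / 2) (half_pos hδ)
  obtain ⟨ε, hε, hlt⟩ := exists_between (lt_min zero_lt_one (lt_min hε₁ hε₂))
  have hlt0 := hlt.trans_le (min_le_left _ _)
  have hlt1 := hlt.trans_le ((min_le_right _ _).trans (min_le_left _ _))
  have hlt2 := hlt.trans_le ((min_le_right _ _).trans (min_le_right _ _))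
  have hσ' := isReparam_convexCombo_id hσc hσm hσ0 hσ1 hε hlt0.le
  have hρ' := isReparam_convexCombo_id hρc hρm hρ0 hρ1 hε hlt0.le
  have hmem : ∀ {φ : ℝ → ℝ}, Monotone φ → φ 0 = 0 → φ 1 = 1 →
      ∀ u ∈ Icc (0 : ℝ) 1, φ u ∈ Icc (0 : ℝ) 1 := fun hm h0 h1 u hu =>
    ⟨h0 ▸ hm hu.1, h1 ▸ hm hu.2⟩
  have hclose : ∀ x ∈ Icc (0 : ℝ) 1, ∀ u ∈ Icc (0 : ℝ) 1,
      |((1 - ε) * x + ε * u) - x| ≤ ε := by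
    intro x hx u hu
    have : ((1 - ε) * x + ε * u) - x = ε * (u - x) := by ring
    rw [this, abs_mul, abs_of_pos hε]
    refine mul_le_of_le_one_right hε.le (abs_le.2 ⟨?_, ?_⟩) <;> linarith [hx.1, hx.2, hu.1, hu.2]
  obtain ⟨g, hg, hρg⟩ := hρ'.exists_inverse
  refine ⟨_, hσ'.comp hg, fun t ht => ?_⟩
  have hu := hg.mapsTo ht
  have e1 := h₁ _ (hσ'.mapsTo hu) _ (hmem hσm hσ0 hσ1 _ hu)
    ((hclose _ (hmem hσm hσ0 hσ1 _ hu) _ hu).trans_lt hlt1)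
  have e2 := h₂ _ (hρ'.mapsTo hu) _ (hmem hρm hρ0 hρ1 _ hu)
    ((hclose _ (hmem hρm hρ0 hρ1 _ hu) _ hu).trans_lt hlt2)
  have e3 := h _ hu
  have e4 := hρg t ht
  simp only [Real.dist_eq] at e1 e2 e4
  rw [e4] at e2
  simp only [Function.comp_apply]
  rw [abs_lt] at e1 e2
  rw [abs_le] at e3 ⊢
  constructor <;> linarith [e1.1, e1.2, e2.1, e2.2, e3.1, e3.2]

/-- On `[a, b]` the curve `τ` runs linearly from the value `v` to the value `w`. -/
def RunsLinearly (τ : ℝ → ℝ) (a b v w : ℝ) : Prop :=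
  a ≤ b ∧ ∀ s ∈ Icc (0 : ℝ) 1, τ (a + s * (b - a)) = v + s * (w - v)

/-- The initial pieces of `τ` on `[0, a]` and of `π` on `[0, x]` admit a weakly monotone
matching of width at most `r`. -/
def Reachable (r : ℝ) (τ π : ℝ → ℝ) (a x : ℝ) : Prop :=
  ∃ (T : ℝ) (σ ρ : ℝ → ℝ), 0 ≤ T ∧ (Continuous σ ∧ Monotone σ ∧ σ 0 = 0 ∧ σ T = a) ∧
    (Continuous ρ ∧ Monotone ρ ∧ ρ 0 = 0 ∧ ρ T = x) ∧
    ∀ u ∈ Icc 0 T, |τ (σ u) - π (ρ u)| ≤ r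

namespace RunsLinearly

variable {τ : ℝ → ℝ} {a b v w : ℝ}

theorem left (h : RunsLinearly τ a b v w) : τ a = v := by
  simpa using h.2 0 (by simp)

theorem right (h : RunsLinearly τ a b v w) : τ b = w := by
  simpa using h.2 1 (by simp)

theorem const_left (h : RunsLinearly τ a b v w) : RunsLinearly τ a a v v :=
  ⟨le_rfl, fun s _ => by simp [h.left]⟩

end RunsLinearly

namespace Reachable

variable {τ π : ℝ → ℝ} {a b x y v w v' w' r : ℝ}

theorem zero (h : |τ 0 - π 0| ≤ r) : Reachable r τ π 0 0 := by
  refine ⟨0, fun _ => 0, fun _ => 0, le_rfl, ⟨continuous_const, monotone_const, rfl, rfl⟩,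
    ⟨continuous_const, monotone_const, rfl, rfl⟩, fun u _ => h⟩

theorem step (h : Reachable r τ π a x) (hτ : RunsLinearly τ a b v w)
    (hπ : RunsLinearly π x y v' w') (hv : |v - v'| ≤ r) (hw : |w - w'| ≤ r) :
    Reachable r τ π b y := by
  obtain ⟨T, σ, ρ, hT, ⟨hσc, hσm, hσ0, hσT⟩, ⟨hρc, hρm, hρ0, hρT⟩, hle⟩ := h
  have hcont : ∀ {φ : ℝ → ℝ} (l : ℝ), Continuous φ →
      Continuous fun u => φ (min u T) + l * max 0 (u - T) := fun l hφ => by fun_prop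
  have hmono : ∀ {φ : ℝ → ℝ} {l : ℝ}, 0 ≤ l → Monotone φ →
      Monotone fun u => φ (min u T) + l * max 0 (u - T) := fun hl hφ p q hpq =>
    add_le_add (hφ (min_le_min_right T hpq))
      (mul_le_mul_of_nonneg_left (max_le_max le_rfl (by linarith)) hl)
  refine ⟨T + 1, fun u => σ (min u T) + (b - a) * max 0 (u - T),
    fun u => ρ (min u T) + (y - x) * max 0 (u - T), by linarith,
    ⟨hcont _ hσc, hmono (sub_nonneg.2 hτ.1) hσm, by simp [hT, hσ0], by simp [hσT]⟩,
    ⟨hcont _ hρc, hmono (sub_nonneg.2 hπ.1) hρm, by simp [hT, hρ0], by simp [hρT]⟩, ?_⟩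
  intro u hu
  rcases le_total u T with huT | huT
  · simpa [huT] using hle u ⟨hu.1, huT⟩
  · have hs : u - T ∈ Icc (0 : ℝ) 1 := ⟨by linarith, by linarith [hu.2]⟩
    have h1 := hτ.2 _ hs
    have h2 := hπ.2 _ hs
    rw [mul_comm] at h1 h2
    simp only [min_eq_right huT, max_eq_right hs.1, hσT, hρT, h1, h2]
    rw [abs_le] at hv hw ⊢
    obtain ⟨hs0, hs1⟩ := hs
    constructor <;> nlinarith [hv.1, hv.2, hw.1, hw.2]

theorem frechetDist_le (h : Reachable r τ π 1 1) (hτ : ContinuousOn τ (Icc 0 1))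
    (hπ : ContinuousOn π (Icc 0 1)) : frechetDist τ π ≤ r := by
  obtain ⟨T, σ, ρ, hT, ⟨hσc, hσm, hσ0, hσT⟩, ⟨hρc, hρm, hρ0, hρT⟩, hle⟩ := h
  have hmono : Monotone fun u : ℝ => T * u := fun p q hpq => mul_le_mul_of_nonneg_left hpq hT
  refine frechetDist_le_of_monotone (σ := fun u => σ (T * u)) (ρ := fun u => ρ (T * u)) hτ hπ
    (by fun_prop) (hσm.comp hmono) (by simpa) (by simpa)
    (by fun_prop) (hρm.comp hmono) (by simpa) (by simpa) fun u hu => ?_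
  exact hle _ ⟨mul_nonneg hT hu.1, mul_le_of_le_one_right hT hu.2⟩

end Reachable

/-! ### Polygonal curves -/

/-- The parameter in `[s, t]` at which the linear function with values `x` at `s` and `y` at `t`
takes the value `v`. -/
noncomputable def edgeParam (s t x y v : ℝ) : ℝ := s + (v - x) / (y - x) * (t - s)

theorem edgeParam_left (s t x y : ℝ) : edgeParam s t x y x = s := by simp [edgeParam]

theorem edgeParam_right (s t : ℝ) {x y : ℝ} (h : x < y) : edgeParam s t x y y = t := by
  rw [edgeParam, div_self (sub_pos.2 h).ne']
  ring

namespace IsPolyOn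

variable {τ : ℝ → ℝ} {m : ℕ} {t w : ℕ → ℝ}

theorem continuousOn (h : IsPolyOn τ m t w) : ContinuousOn τ (Icc 0 1) := by
  obtain ⟨hm, h0, h1, hlt, heq⟩ := h
  have key : ∀ i, i + 1 < m → 0 ≤ t (i + 1) ∧ ContinuousOn τ (Icc 0 (t (i + 1))) := by
    have hedge : ∀ i, i + 1 < m → ContinuousOn τ (Icc (t i) (t (i + 1))) := fun i hi => by
      refine ContinuousOn.congr ?_ (heq i hi)
      fun_prop
    intro i
    induction i with
    | zero =>
      intro hi
      have hcont := hedge 0 hi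
      have hl := hlt 0 hi
      rw [h0] at hcont hl
      exact ⟨hl.le, hcont⟩
    | succ k ih =>
      intro hi
      obtain ⟨hk0, hk⟩ := ih (by omega)
      have hl := hlt (k + 1) hi
      refine ⟨hk0.trans hl.le, ?_⟩
      rw [← Icc_union_Icc_eq_Icc hk0 hl.le]
      exact hk.union_of_isClosed (hedge (k + 1) hi) isClosed_Icc isClosed_Icc
  have := (key (m - 2) (by omega)).2
  rwa [show m - 2 + 1 = m - 1 by omega, h1] at this

theorem runsLinearly (h : IsPolyOn τ m t w) {i : ℕ} (hi : i + 1 < m) :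
    RunsLinearly τ (t i) (t (i + 1)) (w i) (w (i + 1)) := by
  obtain ⟨hm, h0, h1, hlt, heq⟩ := h
  have hl := sub_pos.2 (hlt i hi)
  refine ⟨(hlt i hi).le, fun s hs => ?_⟩
  rw [heq i hi _ ⟨by nlinarith [hs.1], by nlinarith [hs.2]⟩]
  field_simp
  ring

end IsPolyOn

theorem RunsLinearly.edgeParam {τ : ℝ → ℝ} {a b x y v v' : ℝ} (h : RunsLinearly τ a b x y)
    (hxv : x ≤ v) (hvv : v ≤ v') (hvy : v' ≤ y) (hxy : x < y) :
    RunsLinearly τ (edgeParam a b x y v) (edgeParam a b x y v') v v' := by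
  have hpos := sub_pos.2 hxy
  have hab := sub_nonneg.2 h.1
  refine ⟨?_, fun s hs => ?_⟩
  · unfold _root_.edgeParam
    gcongr
  · have hmem : (v + s * (v' - v) - x) / (y - x) ∈ Icc (0 : ℝ) 1 := by
      refine ⟨div_nonneg ?_ hpos.le, (div_le_one hpos).2 ?_⟩ <;> nlinarith [hs.1, hs.2]
    have := h.2 _ hmem
    rw [div_mul_cancel₀ _ hpos.ne'] at this
    rw [show v + s * (v' - v) = x + (v + s * (v' - v) - x) by ring, ← this]
    congr 1
    unfold _root_.edgeParam
    field_simp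
    ring

theorem RunsLinearly.edgeParam_initial {τ : ℝ → ℝ} {a b x y v : ℝ}
    (h : RunsLinearly τ a b x y) (hxv : x ≤ v) (hvy : v ≤ y) (hxy : x < y) :
    RunsLinearly τ a (_root_.edgeParam a b x y v) x v := by
  simpa only [edgeParam_left] using h.edgeParam le_rfl hxv hvy hxy

theorem RunsLinearly.edgeParam_final {τ : ℝ → ℝ} {a b x y v : ℝ}
    (h : RunsLinearly τ a b x y) (hxv : x ≤ v) (hvy : v ≤ y) (hxy : x < y) :
    RunsLinearly τ (_root_.edgeParam a b x y v) b v y := by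
  simpa only [edgeParam_right a b hxy] using h.edgeParam hxv hvy le_rfl hxy

theorem RunsLinearly.apply_eq {τ : ℝ → ℝ} {a b x y u : ℝ} (h : RunsLinearly τ a b x y)
    (hab : a < b) (hu : u ∈ Icc a b) : τ u = x + (u - a) / (b - a) * (y - x) := by
  have hpos := sub_pos.2 hab
  have := h.2 _ ⟨div_nonneg (sub_nonneg.2 hu.1) hpos.le,
    (div_le_one hpos).2 (sub_le_sub_right hu.2 a)⟩
  rwa [div_mul_cancel₀ _ hpos.ne', add_sub_cancel] at this

theorem RunsLinearly.monotoneOn {τ : ℝ → ℝ} {a b x y : ℝ} (h : RunsLinearly τ a b x y)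
    (hab : a < b) (hxy : x ≤ y) : MonotoneOn τ (Icc a b) := by
  intro u hu v hv huv
  have hpos := sub_pos.2 hab
  have hxy' := sub_nonneg.2 hxy
  rw [h.apply_eq hab hu, h.apply_eq hab hv]
  gcongr

theorem RunsLinearly.min_le {τ : ℝ → ℝ} {a b x y u : ℝ} (h : RunsLinearly τ a b x y)
    (hab : a < b) (hu : u ∈ Icc a b) : min x y ≤ τ u := by
  have hpos := sub_pos.2 hab
  have h0 : 0 ≤ (u - a) / (b - a) := div_nonneg (sub_nonneg.2 hu.1) hpos.le
  have h1 : (u - a) / (b - a) ≤ 1 := (div_le_one hpos).2 (sub_le_sub_right hu.2 a)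
  rw [h.apply_eq hab hu]
  rcases le_total x y with hxy | hxy
  · rw [min_eq_left hxy]
    nlinarith
  · rw [min_eq_right hxy]
    nlinarith

/-! ### Curves with vertices `0, x, x - 1/2, M` -/

/-- `τ` runs linearly through the values `0, x, x - 1/2, M` at the parameters `0, a, b, 1`. -/
def IsBump (τ : ℝ → ℝ) (a b x M : ℝ) : Prop :=
  (0 < a ∧ a < b ∧ b < 1) ∧ RunsLinearly τ 0 a 0 x ∧ RunsLinearly τ a b x (x - 1 / 2) ∧
    RunsLinearly τ b 1 (x - 1 / 2) M

theorem IsPolyOn.isBump {τ : ℝ → ℝ} {t : ℕ → ℝ} {x M : ℝ}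
    (h : IsPolyOn τ 4 t (fun j => if j = 0 then 0 else if j = 1 then x
      else if j = 2 then x - 1 / 2 else M)) : IsBump τ (t 1) (t 2) x M := by
  have e0 := h.runsLinearly (i := 0) (by norm_num)
  have e1 := h.runsLinearly (i := 1) (by norm_num)
  have e2 := h.runsLinearly (i := 2) (by norm_num)
  obtain ⟨-, h0, h1, hlt, -⟩ := h
  have l0 := hlt 0 (by norm_num)
  have l1 := hlt 1 (by norm_num)
  have l2 := hlt 2 (by norm_num)
  norm_num at h1 e0 e1 e2 l0 l1 l2
  rw [h0] at e0 l0
  rw [h1] at e2 l2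
  refine ⟨⟨l0, l1, l2⟩, e0, ?_, ?_⟩ <;> norm_num <;> assumption

theorem IsBump.frechetDist_le_quarter {τ π : ℝ → ℝ} {a b a' b' x y M : ℝ}
    (hτ : IsBump τ a b x M) (hπ : IsBump π a' b' y M) (hτc : ContinuousOn τ (Icc 0 1))
    (hπc : ContinuousOn π (Icc 0 1)) (hx : 1 ≤ x) (hxy : x + 1 ≤ y) (hy : y < M) :
    frechetDist τ π ≤ 1 / 4 := by
  obtain ⟨-, p1, p2, p3⟩ := hτ
  obtain ⟨-, q1, q2, q3⟩ := hπ
  have s0 : Reachable (1 / 4) τ π 0 0 := Reachable.zero (by norm_num [p1.left, q1.left])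
  have s1 := s0.step p1 (q1.edgeParam_initial (v := x - 1 / 4) (by linarith) (by linarith)
    (by linarith)) (by norm_num) (by norm_num)
  have s2 := s1.step p2 (q1.edgeParam_final (v := x - 1 / 4) (by linarith) (by linarith)
    (by linarith)).const_left (by norm_num) (by norm_num)
  have s3 := s2.step (p3.edgeParam_initial (v := y - 1 / 4) (by linarith) (by linarith)
    (by linarith)) (q1.edgeParam_final (v := x - 1 / 4) (by linarith) (by linarith)
    (by linarith)) (by norm_num) (by norm_num)
  have s4 := s3.step (p3.edgeParam_final (v := y - 1 / 4) (by linarith) (by linarith)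
    (by linarith)).const_left q2 (by norm_num) (by norm_num)
  have s5 := s4.step (p3.edgeParam_final (v := y - 1 / 4) (by linarith) (by linarith)
    (by linarith)) q3 (by norm_num) (by norm_num)
  exact s5.frechetDist_le hτc hπc

theorem IsBump.quarter_le_frechetDist {τ π : ℝ → ℝ} {a b a' b' x y M : ℝ}
    (hτ : IsBump τ a b x M) (hπ : IsBump π a' b' y M) (hτc : ContinuousOn τ (Icc 0 1))
    (hπc : ContinuousOn π (Icc 0 1)) (hx : 1 ≤ x) (hxy : x + 1 ≤ y) (hy : y < M) :
    1 / 4 ≤ frechetDist τ π := by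
  obtain ⟨⟨ha, hab, hb⟩, p1, p2, -⟩ := hτ
  obtain ⟨⟨ha', hab', hb'⟩, q1, q2, q3⟩ := hπ
  by_contra! hlt
  obtain ⟨f, hf, hclose⟩ := exists_isReparam_of_frechetDist_lt hτc hπc hlt
  obtain ⟨u, hu, hfu⟩ := hf.surjOn ⟨ha.le, (hab.trans hb).le⟩
  obtain ⟨v, hv, hfv⟩ := hf.surjOn ⟨(ha.trans hab).le, hb.le⟩
  have huv : u < v := (hf.2.1.lt_iff_lt hu hv).1 (by rwa [hfu, hfv])
  have hcu := abs_lt.1 (hclose u hu)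
  have hcv := abs_lt.1 (hclose v hv)
  rw [hfu, p1.right] at hcu
  rw [hfv, p2.right] at hcv
  rcases le_total v a' with hva | hva
  · have := q1.monotoneOn ha' (by linarith) ⟨hu.1, huv.le.trans hva⟩ ⟨hv.1, hva⟩ huv.le
    linarith [hcu.1, hcu.2, hcv.1, hcv.2]
  · have hge : y - 1 / 2 ≤ π v := by
      rcases le_total v b' with hvb | hvb
      · exact (le_min (by linarith) le_rfl).trans (q2.min_le hab' ⟨hva, hvb⟩)
      · exact (le_min le_rfl (by linarith)).trans (q3.min_le hb' ⟨hvb, hv.2⟩)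
    linarith [hcv.1]

theorem IsBump.frechetDist_eq_quarter {τ π : ℝ → ℝ} {a b a' b' x y M : ℝ}
    (hτ : IsBump τ a b x M) (hπ : IsBump π a' b' y M) (hτc : ContinuousOn τ (Icc 0 1))
    (hπc : ContinuousOn π (Icc 0 1)) (hx : 1 ≤ x) (hxy : x + 1 ≤ y) (hy : y < M) :
    frechetDist τ π = 1 / 4 :=
  le_antisymm (hτ.frechetDist_le_quarter hπ hτc hπc hx hxy hy)
    (hτ.quarter_le_frechetDist hπ hτc hπc hx hxy hy)

/-! ### The zigzag curve -/

/-- The vertex values `0, 7/8, 5/8, …, i - 1/8, i - 3/8, …, n - 1/8, n - 3/8, M`. -/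
noncomputable def zigzagVertex (n : ℕ) (M : ℝ) (j : ℕ) : ℝ :=
  if j = 0 then 0
  else if j = 2 * n + 1 then M
  else if j % 2 = 1 then (((j + 1) / 2 : ℕ) : ℝ) - 1 / 8
  else ((j / 2 : ℕ) : ℝ) - 3 / 8

theorem zigzagVertex_odd {n k : ℕ} (M : ℝ) (hk : k < n) :
    zigzagVertex n M (2 * k + 1) = (k : ℝ) + 1 - 1 / 8 := by
  rw [zigzagVertex, if_neg (by omega), if_neg (by omega), if_pos (by omega),
    show (2 * k + 1 + 1) / 2 = k + 1 by omega]
  push_cast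
  ring

theorem zigzagVertex_even {n k : ℕ} (M : ℝ) (hk : 1 ≤ k) :
    zigzagVertex n M (2 * k) = (k : ℝ) - 3 / 8 := by
  rw [zigzagVertex, if_neg (by omega), if_neg (by omega), if_neg (by omega),
    show 2 * k / 2 = k by omega]

theorem zigzagVertex_last (n : ℕ) (M : ℝ) : zigzagVertex n M (2 * n + 1) = M := by
  rw [zigzagVertex, if_neg (by omega), if_pos rfl]

theorem IsBump.frechetDist_zigzag_le {τ c : ℝ → ℝ} {a b M : ℝ} {n i : ℕ} {t : ℕ → ℝ}
    (hτ : IsBump τ a b i M) (hc : IsPolyOn c (2 * n + 2) t (zigzagVertex n M))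
    (hτc : ContinuousOn τ (Icc 0 1)) (hi : 1 ≤ i) (hin : i ≤ n) (hM : n < M) :
    frechetDist τ c ≤ 1 / 8 := by
  obtain ⟨-, p1, p2, p3⟩ := hτ
  have ht0 : t 0 = 0 := hc.2.1
  have ht1 : t (2 * n + 1) = 1 := hc.2.2.1
  have hi' : (1 : ℝ) ≤ i := by exact_mod_cast hi
  have hin' : (i : ℝ) ≤ n := by exact_mod_cast hin
  have first : RunsLinearly c 0 (t 1) 0 (7 / 8) := by
    have := hc.runsLinearly (i := 0) (by omega)
    rw [ht0, show 0 + 1 = 2 * 0 + 1 by rfl, zigzagVertex_odd M (by omega)] at this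
    norm_num [zigzagVertex] at this
    exact this
  have up : ∀ k, 1 ≤ k → k < n →
      RunsLinearly c (t (2 * k)) (t (2 * k + 1)) (k - 3 / 8) (k + 1 - 1 / 8) := fun k h1 h2 => by
    have := hc.runsLinearly (i := 2 * k) (by omega)
    rwa [zigzagVertex_even M h1, zigzagVertex_odd M h2] at this
  have down : ∀ k, k < n →
      RunsLinearly c (t (2 * k + 1)) (t (2 * (k + 1))) (k + 1 - 1 / 8) (k + 1 - 3 / 8) :=
    fun k hk => by
      have := hc.runsLinearly (i := 2 * k + 1) (by omega)
      rw [zigzagVertex_odd M hk, show 2 * k + 1 + 1 = 2 * (k + 1) by ring,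
        zigzagVertex_even M (by omega)] at this
      exact_mod_cast this
  have last : RunsLinearly c (t (2 * n)) 1 (n - 3 / 8) M := by
    have := hc.runsLinearly (i := 2 * n) (by omega)
    rwa [zigzagVertex_even M (by omega), zigzagVertex_last, ht1] at this
  have start : Reachable (1 / 8) τ c 0 0 := Reachable.zero (by norm_num [p1.left, first.left])
  have before : ∀ k : ℕ, k + 1 < i →
      Reachable (1 / 8) τ c (edgeParam 0 a 0 i (k + 1 - 1 / 4)) (t (2 * (k + 1))) := by
    intro k
    induction k with
    | zero =>
      intro h
      have h' : (0 : ℝ) + 1 + 1 ≤ i := by exact_mod_cast h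
      have dn := down 0 (by omega)
      norm_num at dn ⊢
      have e := p1.edgeParam (v := 3 / 4) (v' := 3 / 4) (by linarith) le_rfl (by linarith)
        (by linarith)
      exact (start.step (p1.edgeParam_initial (by linarith) (by linarith) (by linarith)) first
        (by norm_num) (by norm_num [abs_le])).step e dn (by norm_num [abs_le])
        (by norm_num [abs_le])
    | succ k ih =>
      intro h
      have h' : (k : ℝ) + 1 + 1 + 1 ≤ i := by exact_mod_cast h
      have hk : (0 : ℝ) ≤ k := k.cast_nonneg
      have u := up (k + 1) (by omega) (by omega)
      have dn := down (k + 1) (by omega)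
      push_cast at u dn ⊢
      refine ((ih (by omega)).step (p1.edgeParam (v' := k + 1 + 1 - 1 / 4) (by linarith)
        (by linarith) (by linarith) (by linarith)) u ?_ ?_).step
        (p1.edgeParam (by linarith) le_rfl (by linarith) (by linarith)) dn ?_ ?_
      all_goals rw [abs_le]; constructor <;> linarith
  have peak : Reachable (1 / 8) τ c a (t (2 * (i - 1) + 1)) := by
    obtain ⟨k, rfl⟩ : ∃ k, i = k + 1 := ⟨i - 1, by omega⟩
    rcases k with _ | k
    · push_cast at p1
      norm_num at p1 ⊢
      exact start.step p1 first (by norm_num) (by norm_num [abs_le])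
    · have u := up (k + 1) (by omega) (by omega)
      have hk : (0 : ℝ) ≤ k := k.cast_nonneg
      have hb := before k (by omega)
      push_cast at u hb p1
      refine hb.step (p1.edgeParam_final (by linarith) (by linarith) (by linarith)) u ?_ ?_
      all_goals rw [abs_le]; constructor <;> linarith
  have after : ∀ k : ℕ, i + k ≤ n → ∃ v : ℝ, |v - (i + k - 3 / 8)| ≤ 1 / 8 ∧ i - 1 / 2 ≤ v ∧
      Reachable (1 / 8) τ c (edgeParam b 1 (i - 1 / 2) M v) (t (2 * (i + k))) := by
    intro k
    induction k with
    | zero =>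
      intro _
      refine ⟨i - 1 / 2, by norm_num [abs_le], le_rfl, ?_⟩
      have dn := down (i - 1) (by omega)
      rw [Nat.sub_add_cancel hi, Nat.cast_sub hi] at dn
      rw [edgeParam_left]
      refine peak.step p2 dn ?_ ?_
      all_goals push_cast; rw [abs_le]; constructor <;> linarith
    | succ k ih =>
      intro h
      obtain ⟨v, hv, hiv, hr⟩ := ih (by omega)
      have hk : (0 : ℝ) ≤ k := k.cast_nonneg
      have h' : (i : ℝ) + (k + 1) ≤ n := by exact_mod_cast h
      have u := up (i + k) (by omega) (by omega)
      have dn := down (i + k) (by omega)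
      push_cast at u dn ⊢
      have hv' := abs_le.1 hv
      refine ⟨i + (k + 1) - 1 / 4, by rw [abs_le]; constructor <;> linarith, by linarith, ?_⟩
      refine (hr.step (p3.edgeParam (v' := i + (k + 1) - 1 / 4) hiv (by linarith) (by linarith)
        (by linarith)) u hv ?_).step
        (p3.edgeParam (by linarith) le_rfl (by linarith) (by linarith)) dn ?_ ?_
      all_goals rw [abs_le]; constructor <;> linarith
  obtain ⟨v, hv, hiv, hr⟩ := after (n - i) (by omega)
  rw [Nat.cast_sub hin, add_sub_cancel] at hv
  rw [Nat.add_sub_cancel' hin] at hr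
  have hv' := abs_le.1 hv
  exact (hr.step (p3.edgeParam_final hiv (by linarith) (by linarith)) last hv
    (by norm_num)).frechetDist_le hτc hc.continuousOn

/-- Lemma 8.3: for every positive integer `d`, the `2^d + 1`
polygonal curves `τ i` with vertex sequence `(0, i, i - 1/2, 2^d + 2)`
(`i = 1, …, 2^d + 1`) all lie within Fréchet distance `1/8` of the curve `c` with
vertex sequence `(0, 7/8, 5/8, …, i - 1/8, i - 3/8, …, 2^d + 7/8, 2^d + 5/8,
2^d + 2)`, while `d_F(τ i, τ j) = 1/4` for `i ≠ j`. Consequently there is a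
closed ball of radius `1/8` in the space of polygonal curves under the Fréchet
distance which cannot be covered by `2^d` closed balls of radius `1/16`; hence
the doubling dimension of this metric space is unbounded. -/
theorem doubling_dimension_unbounded (d : ℕ) (hd : 0 < d)
    (τ : ℕ → ℝ → ℝ) (tτ : ℕ → ℕ → ℝ)
    (hτ : ∀ i, 1 ≤ i → i ≤ 2 ^ d + 1 → IsPolyOn (τ i) 4 (tτ i)
      (fun j => if j = 0 then 0 else if j = 1 then (i : ℝ)
        else if j = 2 then (i : ℝ) - 1 / 2 else (2 : ℝ) ^ d + 2))
    (c : ℝ → ℝ) (tc : ℕ → ℝ)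
    (hc : IsPolyOn c (2 * (2 ^ d + 1) + 2) tc
      (fun j => if j = 0 then 0
        else if j = 2 * (2 ^ d + 1) + 1 then (2 : ℝ) ^ d + 2
        else if j % 2 = 1 then (((j + 1) / 2 : ℕ) : ℝ) - 1 / 8
        else ((j / 2 : ℕ) : ℝ) - 3 / 8)) :
    (∀ i, 1 ≤ i → i ≤ 2 ^ d + 1 → frechetDist (τ i) c ≤ 1 / 8) ∧
    (∀ i j, 1 ≤ i → i ≤ 2 ^ d + 1 → 1 ≤ j → j ≤ 2 ^ d + 1 → i ≠ j →
      frechetDist (τ i) (τ j) = 1 / 4) ∧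
    (∃ p : ℝ → ℝ, IsPolyCurve p ∧
      ∀ q : Fin (2 ^ d) → ℝ → ℝ, (∀ a, IsPolyCurve (q a)) →
        ∃ z : ℝ → ℝ, IsPolyCurve z ∧ frechetDist p z ≤ 1 / 8 ∧
          ∀ a, 1 / 16 < frechetDist (q a) z) := by
  have hcc := hc.continuousOn
  have hτc : ∀ i, 1 ≤ i → i ≤ 2 ^ d + 1 → ContinuousOn (τ i) (Icc 0 1) :=
    fun i h1 h2 => (hτ i h1 h2).continuousOn
  have hball : ∀ i, 1 ≤ i → i ≤ 2 ^ d + 1 → frechetDist (τ i) c ≤ 1 / 8 := fun i h1 h2 =>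
    (hτ i h1 h2).isBump.frechetDist_zigzag_le hc (hτc i h1 h2) h1 h2 (by push_cast; linarith)
  have hlt : ∀ i j, 1 ≤ i → i < j → j ≤ 2 ^ d + 1 → frechetDist (τ i) (τ j) = 1 / 4 := by
    intro i j hi hij hj
    have hj' : (j : ℝ) ≤ 2 ^ d + 1 := by exact_mod_cast hj
    exact (hτ i hi (hij.le.trans hj)).isBump.frechetDist_eq_quarter
      (hτ j (hi.trans hij.le) hj).isBump (hτc i hi (hij.le.trans hj)) (hτc j (hi.trans hij.le) hj)
      (by exact_mod_cast hi) (by exact_mod_cast hij) (by linarith)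
  have hdist : ∀ i j, 1 ≤ i → i ≤ 2 ^ d + 1 → 1 ≤ j → j ≤ 2 ^ d + 1 → i ≠ j →
      frechetDist (τ i) (τ j) = 1 / 4 := by
    intro i j hi hi' hj hj' hij
    rcases hij.lt_or_gt with h | h
    · exact hlt i j hi h hj'
    · rw [frechetDist_comm (hτc i hi hi') (hτc j hj hj')]
      exact hlt j i hj h hi'
  refine ⟨hball, hdist, c, ⟨_, _, _, hc⟩, fun q hq => ?_⟩
  by_contra! hcon
  have hmem : ∀ i : Fin (2 ^ d + 1), 1 ≤ (i : ℕ) + 1 ∧ (i : ℕ) + 1 ≤ 2 ^ d + 1 := fun i =>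
    ⟨by omega, i.isLt⟩
  have hcover : ∀ i : Fin (2 ^ d + 1), ∃ a, frechetDist (q a) (τ (i + 1)) ≤ 1 / 16 := fun i => by
    obtain ⟨h1, h2⟩ := hmem i
    refine hcon _ ⟨_, _, _, hτ _ h1 h2⟩ ?_
    rw [frechetDist_comm hcc (hτc _ h1 h2)]
    exact hball _ h1 h2
  choose F hF using hcover
  obtain ⟨i, j, hij, hFij⟩ := Fintype.exists_ne_map_eq_of_card_lt F (by simp)
  obtain ⟨hi1, hi2⟩ := hmem i
  obtain ⟨hj1, hj2⟩ := hmem j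
  have hqc : ContinuousOn (q (F i)) (Icc 0 1) := by
    obtain ⟨m, t, w, h⟩ := hq (F i)
    exact h.continuousOn
  have h1 := hdist _ _ hi1 hi2 hj1 hj2 fun h => hij (Fin.ext (by omega))
  have h2 := frechetDist_triangle (hτc _ hi1 hi2) hqc (hτc _ hj1 hj2)
  have h3 := hF i
  have h4 := hF j
  rw [← hFij] at h4
  rw [frechetDist_comm (hτc _ hi1 hi2) hqc] at h2
  linarith
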